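/- arXiv:0809.0643 — 14 statements merged into one kernel-verified Lean document; each statement's English description precedes it below -/
import Mathlib

section
/- In the free ℤ-module L with basis h, e₁, …, e₈ and bilinear form B as above, with κ = 2h − e₁ − ⋯ − e₈ and κ^⊥ = {v ∈ L : B(v,κ)=0}: the restriction of B to κ^⊥ is negative semidefinite (B(v,v) ≤ 0 for every v ∈ κ^⊥), and the radical {v ∈ κ^⊥ : B(v,w) = 0 for all w ∈ κ^⊥} is exactly the subgroup ℤκ generated by κ. -/
noncomputable section

/-- The free ℤ-module `L` with basis `h, e₁, …, e₈` is modeled as `Fin 9 → ℤ`,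
where coordinate `0` corresponds to `h` and coordinate `i.succ` to `eᵢ₊₁`.
`B` is the symmetric bilinear form with `B(h,h) = 2`, `B(eᵢ,eᵢ) = -1`,
`B(h,eᵢ) = 0` and `B(eᵢ,eⱼ) = 0` for `i ≠ j`. -/
def B (v w : Fin 9 → ℤ) : ℤ :=
  2 * v 0 * w 0 - ∑ i : Fin 8, v i.succ * w i.succ

/-- The vector `κ = 2h - e₁ - ⋯ - e₈`. -/
def kappa : Fin 9 → ℤ := fun i => if i = 0 then 2 else -1

theorem B_kappa_right (v : Fin 9 → ℤ) : B v kappa = 4 * v 0 + ∑ i : Fin 8, v i.succ := by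
  simp only [B, kappa, Fin.succ_ne_zero, if_true, if_false, mul_neg, mul_one,
    Finset.sum_neg_distrib]
  ring

theorem B_smul_kappa_left (n : ℤ) (w : Fin 9 → ℤ) : B (n • kappa) w = n * B w kappa := by
  simp only [B, Pi.smul_apply, smul_eq_mul, mul_sub, Finset.mul_sum]
  congr 1
  · ring
  · exact Finset.sum_congr rfl fun i _ => by ring

/-- Pairing with the difference `eᵢ - eⱼ`. -/
theorem B_single_sub_single (v : Fin 9 → ℤ) (i j : Fin 8) :
    B v (Pi.single i.succ 1 - Pi.single j.succ 1) = v j.succ - v i.succ := by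
  simp [B, Pi.single_apply, mul_sub, Finset.sum_sub_distrib, (Fin.succ_ne_zero _).symm]

theorem B_single_sub_single_kappa (i j : Fin 8) :
    B (Pi.single i.succ 1 - Pi.single j.succ 1) kappa = 0 := by
  simp [B_kappa_right, Pi.single_apply, Finset.sum_sub_distrib, (Fin.succ_ne_zero _).symm]

theorem B_self_nonpos_of_B_kappa_eq_zero {v : Fin 9 → ℤ} (hv : B v kappa = 0) : B v v ≤ 0 := by
  rw [B_kappa_right] at hv
  have hcs := sq_sum_le_card_mul_sum_sq (s := Finset.univ) (f := fun i : Fin 8 => v i.succ)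
  have hsum : ∑ i : Fin 8, v i.succ = -4 * v 0 := by linarith
  rw [hsum, Finset.card_univ, Fintype.card_fin] at hcs
  simp only [B, ← pow_two]
  push_cast at hcs
  linarith

theorem eq_smul_kappa_of_forall_B_eq_zero {v : Fin 9 → ℤ} (hv : B v kappa = 0)
    (h : ∀ w : Fin 9 → ℤ, B w kappa = 0 → B v w = 0) : v = (-v 1) • kappa := by
  have hconst (i : Fin 8) : v i.succ = v 1 := by
    have hpair := h _ (B_single_sub_single_kappa i 0)
    rw [B_single_sub_single] at hpair
    exact (sub_eq_zero.mp hpair).symm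
  rw [B_kappa_right] at hv
  simp only [hconst, Finset.sum_const, Finset.card_univ, Fintype.card_fin,
    nsmul_eq_mul, Nat.cast_ofNat] at hv
  funext i
  refine Fin.cases ?_ (fun j => ?_) i
  · simp only [kappa, Pi.smul_apply, smul_eq_mul, if_true]
    linarith
  · simp [kappa, hconst]

/-- The restriction of `B` to `κ^⊥ = {v : B(v,κ) = 0}` is negative semidefinite, and the
radical `{v ∈ κ^⊥ : B(v,w) = 0 for all w ∈ κ^⊥}` is exactly the subgroup `ℤκ`. -/
theorem kappa_perp_negSemidef_and_radical :
    (∀ v : Fin 9 → ℤ, B v kappa = 0 → B v v ≤ 0) ∧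
    (∀ v : Fin 9 → ℤ,
      (B v kappa = 0 ∧ ∀ w : Fin 9 → ℤ, B w kappa = 0 → B v w = 0) ↔
        ∃ n : ℤ, v = n • kappa) := by
  refine ⟨fun v => B_self_nonpos_of_B_kappa_eq_zero, fun v => ⟨?_, ?_⟩⟩
  · rintro ⟨hv, h⟩
    exact ⟨_, eq_smul_kappa_of_forall_B_eq_zero hv h⟩
  · rintro ⟨n, rfl⟩
    refine ⟨?_, fun w hw => by rw [B_smul_kappa_left, hw, mul_zero]⟩
    rw [B_smul_kappa_left, B_kappa_right]
    simp [kappa]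

end
end

section
/- Let k be an infinite field and let Q₁, Q₂, Q₃ ∈ k[X,Y,Z,W] be homogeneous polynomials of degree 2 whose set of common projective zeros is finite. Then no three common projective zeros are collinear; that is, there do not exist pairwise non-proportional common zeros u, v, w ∈ k⁴ ∖ {0} of Q₁, Q₂, Q₃ with w belonging to the linear span of u and v. -/
open MvPolynomial

namespace MvPolynomial

variable {σ R : Type*} [CommRing R]

/-- A linear form is additive and homogeneous as a function of its argument. -/
lemma IsHomogeneous.eval_smul_add_smul_of_one {L : MvPolynomial σ R} (hL : L.IsHomogeneous 1)
    (u v : σ → R) (s t : R) :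
    eval (s • u + t • v) L = s * eval u L + t * eval v L := by
  rw [← mem_homogeneousSubmodule, homogeneousSubmodule_one_eq_span_X] at hL
  induction hL using Submodule.span_induction with
  | mem x hx => obtain ⟨i, rfl⟩ := hx; simp
  | zero => simp
  | add x y _ _ hx hy => simp only [map_add, hx, hy]; ring
  | smul a x _ hx => simp only [smul_eval, hx]; ring

/-- A quadratic form restricted to the span of two vectors is a binary quadratic form. -/
lemma IsHomogeneous.exists_eval_smul_add_smul_of_two {Q : MvPolynomial σ R}
    (hQ : Q.IsHomogeneous 2) (u v : σ → R) :
    ∃ b : R, ∀ s t : R,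
      eval (s • u + t • v) Q = s ^ 2 * eval u Q + s * t * b + t ^ 2 * eval v Q := by
  rw [← mem_homogeneousSubmodule, ← homogeneousSubmodule_one_pow, pow_two] at hQ
  induction hQ using Submodule.mul_induction_on' with
  | mem_mul_mem L hL M hM =>
    rw [mem_homogeneousSubmodule] at hL hM
    refine ⟨eval u L * eval v M + eval v L * eval u M, fun s t ↦ ?_⟩
    simp only [map_mul, hL.eval_smul_add_smul_of_one, hM.eval_smul_add_smul_of_one]
    ring
  | add P _ P' _ hP hP' =>
    obtain ⟨b, hb⟩ := hP
    obtain ⟨b', hb'⟩ := hP'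
    refine ⟨b + b', fun s t ↦ ?_⟩
    simp only [map_add, hb, hb']
    ring

/-- A quadratic form with three distinct projective zeros on a line vanishes on that line. -/
lemma IsHomogeneous.eval_smul_add_smul_eq_zero_of_two [IsDomain R] {Q : MvPolynomial σ R}
    (hQ : Q.IsHomogeneous 2) {u v : σ → R} {a b : R} (ha : a ≠ 0) (hb : b ≠ 0)
    (hu : eval u Q = 0) (hv : eval v Q = 0) (hw : eval (a • u + b • v) Q = 0) (s t : R) :
    eval (s • u + t • v) Q = 0 := by
  obtain ⟨B, hB⟩ := hQ.exists_eval_smul_add_smul_of_two u v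
  have hB0 : B = 0 := by simpa [hB, hu, hv, ha, hb] using hw
  simp [hB, hu, hv, hB0]

end MvPolynomial

/-- Over an infinite field, a finite set of points does not meet every class of proportional
vectors of a plane. -/
lemma LinearIndependent.exists_add_smul_ne_smul {k V : Type*} [Field k] [Infinite k]
    [AddCommGroup V] [Module k V] {u v : V} (h : LinearIndependent k ![u, v]) (T : Finset V) :
    ∃ t : k, ∀ x ∈ T, ∀ c : k, c ≠ 0 → u + t • v ≠ c • x := by
  by_contra! H
  choose f hf c hc hfc using H
  obtain ⟨t, t', hne, heq⟩ :=
    Finite.exists_ne_map_eq_of_infinite (fun t ↦ (⟨f t, hf t⟩ : T))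
  have hx : f t = f t' := congrArg Subtype.val heq
  have hrel : (c t' - c t) • u + (c t' * t - c t * t') • v = 0 := by
    calc (c t' - c t) • u + (c t' * t - c t * t') • v
        = c t' • (u + t • v) - c t • (u + t' • v) := by module
      _ = 0 := by rw [hfc t, hfc t', hx]; module
  obtain ⟨h₁, h₂⟩ := LinearIndependent.pair_iff.1 h _ _ hrel
  rw [sub_eq_zero.1 h₁, ← mul_sub] at h₂
  exact hne (sub_eq_zero.1 ((mul_eq_zero.1 h₂).resolve_left (hc t)))

/-- If `Q₁, Q₂, Q₃ ∈ k[X,Y,Z,W]` are homogeneous of degree 2 over an infinite field and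
their common projective zeros are finite (i.e. the nonzero common zeros fall into finitely
many scalar-proportionality classes), then no three common projective zeros are collinear:
there are no pairwise non-proportional nonzero common zeros `u, v, w` with
`w ∈ span{u, v}`. -/
theorem no_three_collinear_basepoints {k : Type*} [Field k] [Infinite k]
    (Q₁ Q₂ Q₃ : MvPolynomial (Fin 4) k)
    (hQ₁ : Q₁.IsHomogeneous 2) (hQ₂ : Q₂.IsHomogeneous 2) (hQ₃ : Q₃.IsHomogeneous 2)
    (hfin : ∃ T : Finset (Fin 4 → k), ∀ v : Fin 4 → k, v ≠ 0 →
      eval v Q₁ = 0 → eval v Q₂ = 0 → eval v Q₃ = 0 →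
      ∃ u ∈ T, ∃ c : k, c ≠ 0 ∧ v = c • u) :
    ¬ ∃ u v w : Fin 4 → k,
        u ≠ 0 ∧ v ≠ 0 ∧ w ≠ 0 ∧
        eval u Q₁ = 0 ∧ eval u Q₂ = 0 ∧ eval u Q₃ = 0 ∧
        eval v Q₁ = 0 ∧ eval v Q₂ = 0 ∧ eval v Q₃ = 0 ∧
        eval w Q₁ = 0 ∧ eval w Q₂ = 0 ∧ eval w Q₃ = 0 ∧
        (¬ ∃ c : k, v = c • u) ∧ (¬ ∃ c : k, w = c • u) ∧ (¬ ∃ c : k, w = c • v) ∧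
        w ∈ Submodule.span k ({u, v} : Set (Fin 4 → k)) := by
  rintro ⟨u, v, w, hu, -, -, hu₁, hu₂, hu₃, hv₁, hv₂, hv₃, hw₁, hw₂, hw₃, huv, huw, hvw, hw⟩
  obtain ⟨T, hT⟩ := hfin
  obtain ⟨a, b, rfl⟩ := Submodule.mem_span_pair.1 hw
  have ha : a ≠ 0 := by
    rintro rfl
    exact hvw ⟨b, by simp⟩
  have hb : b ≠ 0 := by
    rintro rfl
    exact huw ⟨a, by simp⟩
  have hli : LinearIndependent k ![u, v] :=
    (LinearIndependent.pair_iff' hu).2 fun c hc ↦ huv ⟨c, hc.symm⟩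
  obtain ⟨t, ht⟩ := hli.exists_add_smul_ne_smul T
  have hne : u + t • v ≠ 0 := fun h ↦
    one_ne_zero (LinearIndependent.pair_iff.1 hli 1 t (by rwa [one_smul])).1
  obtain ⟨x, hx, c, hc, hxc⟩ := hT (u + t • v) hne
    (by simpa using hQ₁.eval_smul_add_smul_eq_zero_of_two ha hb hu₁ hv₁ hw₁ 1 t)
    (by simpa using hQ₂.eval_smul_add_smul_eq_zero_of_two ha hb hu₂ hv₂ hw₂ 1 t)
    (by simpa using hQ₃.eval_smul_add_smul_eq_zero_of_two ha hb hu₃ hv₃ hw₃ 1 t)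
  exact ht x hx c hc hxc
end

section
/- Let k be an infinite field and let Q₁, Q₂, Q₃ ∈ k[X,Y,Z,W] be homogeneous polynomials of degree 2 whose set of common projective zeros is finite. Then no five common projective zeros are coplanar; that is, there do not exist five pairwise non-proportional common zeros v₁,…,v₅ ∈ k⁴ ∖ {0} of Q₁, Q₂, Q₃ all lying in a common 3-dimensional linear subspace of k⁴. -/
open MvPolynomial

/-- A homogeneous polynomial of degree two is the diagonal of a bilinear form. -/
lemma MvPolynomial.IsHomogeneous.exists_bilinForm {σ k : Type*} [Field k]
    {Q : MvPolynomial σ k} (hQ : Q.IsHomogeneous 2) :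
    ∃ B : LinearMap.BilinForm k (σ → k), ∀ v, eval v Q = B v v := by
  have linear {L : MvPolynomial σ k} (hL : L ∈ homogeneousSubmodule σ k 1) :
      ∃ f : (σ → k) →ₗ[k] k, ∀ v, eval v L = f v := by
    rw [homogeneousSubmodule_one_eq_span_X] at hL
    induction hL using Submodule.span_induction with
    | mem _ h =>
      obtain ⟨i, rfl⟩ := h
      exact ⟨LinearMap.proj i, by simp⟩
    | zero => exact ⟨0, by simp⟩
    | add _ _ _ _ hf hg =>
      obtain ⟨f, hf⟩ := hf
      obtain ⟨g, hg⟩ := hg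
      exact ⟨f + g, by simp [hf, hg]⟩
    | smul c _ _ hf =>
      obtain ⟨f, hf⟩ := hf
      exact ⟨c • f, by simp [hf]⟩
  have hmem : Q ∈ homogeneousSubmodule σ k 1 * homogeneousSubmodule σ k 1 := by
    rwa [← pow_two, homogeneousSubmodule_one_pow, mem_homogeneousSubmodule]
  clear hQ
  induction hmem using Submodule.mul_induction_on' with
  | mem_mul_mem L hL M hM =>
    obtain ⟨f, hf⟩ := linear hL
    obtain ⟨g, hg⟩ := linear hM
    exact ⟨LinearMap.BilinForm.linMulLin f g, by simp [hf, hg]⟩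
  | add P _ R _ hP hR =>
    obtain ⟨B, hB⟩ := hP
    obtain ⟨C, hC⟩ := hR
    exact ⟨B + C, by simp [hB, hC]⟩

/-- If every nonzero vector with property `Z` is proportional to one of finitely many vectors,
then a family indexed by an infinite set cannot consist of nonzero, pairwise non-proportional
vectors with property `Z`. -/
lemma false_of_infinite_nonproportional {k V ι : Type*} [Field k] [AddCommGroup V] [Module k V]
    {Z : V → Prop} {T : Finset V}
    (hT : ∀ v, v ≠ 0 → Z v → ∃ u ∈ T, ∃ c : k, c ≠ 0 ∧ v = c • u)
    {S : Set ι} (hS : S.Infinite) (w : ι → V) (hw : ∀ t ∈ S, w t ≠ 0) (hZ : ∀ t ∈ S, Z (w t))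
    (hinj : ∀ t ∈ S, ∀ t' ∈ S, (∃ c : k, w t' = c • w t) → t = t') : False := by
  choose! u hu c hc hwu using fun t ht ↦ hT (w t) (hw t ht) (hZ t ht)
  obtain ⟨t, ht, t', ht', hne, heq⟩ := hS.exists_ne_map_eq_of_mapsTo (f := u) hu T.finite_toSet
  refine hne (hinj t ht t' ht' ⟨c t' * (c t)⁻¹, ?_⟩)
  rw [hwu t ht, hwu t' ht', heq, smul_smul, inv_mul_cancel_right₀ (hc t ht)]

/-- If three pairwise non-proportional zeros of the quadratic maps `B i` are collinear, then
the zeros do not fall into finitely many proportionality classes. -/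
lemma false_of_collinear_zeros {k V ι : Type*} [Field k] [Infinite k] [AddCommGroup V] [Module k V]
    {B : ι → LinearMap.BilinForm k V} {T : Finset V}
    (hT : ∀ v, v ≠ 0 → (∀ i, B i v v = 0) → ∃ u ∈ T, ∃ c : k, c ≠ 0 ∧ v = c • u)
    {x y z : V} (hx : ∀ i, B i x x = 0) (hy : ∀ i, B i y y = 0) (hz : ∀ i, B i z z = 0)
    (hxy : LinearIndependent k ![x, y])
    (hxz : ¬ ∃ c : k, z = c • x) (hyz : ¬ ∃ c : k, z = c • y)
    {a b : k} (h : z = a • x + b • y) : False := by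
  have ha : a ≠ 0 := fun ha ↦ hyz ⟨b, by simp [h, ha]⟩
  have hb : b ≠ 0 := fun hb ↦ hxz ⟨a, by simp [h, hb]⟩
  rw [LinearIndependent.pair_iff] at hxy
  refine false_of_infinite_nonproportional hT (Set.infinite_univ (α := k))
    (fun t ↦ x + t • y) (fun t _ h0 ↦ ?_) (fun t _ i ↦ ?_) (fun t _ t' _ ⟨c, hc⟩ ↦ ?_)
  · exact one_ne_zero (hxy 1 t (by simpa using h0)).1
  · have hzi := hz i
    simp only [h, map_add, map_smul, LinearMap.add_apply, LinearMap.smul_apply, smul_eq_mul,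
      hx, hy] at hzi ⊢
    have : B i x y + B i y x = 0 := by
      apply mul_left_cancel₀ (mul_ne_zero ha hb)
      linear_combination hzi
    linear_combination t * this
  · obtain ⟨h1, h2⟩ := hxy (1 - c) (t' - c * t) (by
      rw [sub_smul, sub_smul, mul_smul, one_smul, sub_add_sub_comm, hc, smul_add, sub_self])
    linear_combination t * h1 - h2

/-- If `x, y, z` are linearly independent zeros of the quadratic maps `B i`, and two further
non-proportional zeros have only nonzero coordinates with respect to `x, y, z`, then the zeros do
not fall into finitely many proportionality classes. -/
lemma false_of_five_general_zeros {k V ι : Type*} [Field k] [Infinite k] [AddCommGroup V]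
    [Module k V] {B : ι → LinearMap.BilinForm k V} {T : Finset V}
    (hT : ∀ v, v ≠ 0 → (∀ i, B i v v = 0) → ∃ u ∈ T, ∃ c : k, c ≠ 0 ∧ v = c • u)
    {x y z : V} (hx : ∀ i, B i x x = 0) (hy : ∀ i, B i y y = 0) (hz : ∀ i, B i z z = 0)
    (hli : ∀ r s t : k, r • x + s • y + t • z = 0 → r = 0 ∧ s = 0 ∧ t = 0)
    {a b c p q r : k} (ha : a ≠ 0) (hb : b ≠ 0) (hc : c ≠ 0)
    (hp : p ≠ 0) (hq : q ≠ 0) (hr : r ≠ 0)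
    (hu : ∀ i, B i (a • x + b • y + c • z) (a • x + b • y + c • z) = 0)
    (hv : ∀ i, B i (p • x + q • y + r • z) (p • x + q • y + r • z) = 0)
    (huv : ¬ ∃ d : k, p • x + q • y + r • z = d • (a • x + b • y + c • z)) : False := by
  -- The base conic, parametrised by applying the Cremona involution to a line.
  let S : Set k := {t | p + t * a ≠ 0 ∧ q + t * b ≠ 0 ∧ r + t * c ≠ 0}
  have hS : S.Infinite := by
    refine (Set.toFinite ({-p / a, -q / b, -r / c} : Set k)).infinite_compl.mono ?_
    intro t ht
    simp only [Set.mem_compl_iff, Set.mem_insert_iff,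
      Set.mem_singleton_iff, not_or, eq_div_iff ha, eq_div_iff hb, eq_div_iff hc] at ht
    exact ⟨fun h ↦ ht.1 (by linear_combination h), fun h ↦ ht.2.1 (by linear_combination h),
      fun h ↦ ht.2.2 (by linear_combination h)⟩
  refine false_of_infinite_nonproportional hT hS
    (fun t ↦ (a * p * ((q + t * b) * (r + t * c))) • x + (b * q * ((p + t * a) * (r + t * c))) • y
      + (c * r * ((p + t * a) * (q + t * b))) • z)
    (fun t ht h0 ↦ ?_) (fun t _ i ↦ ?_) (fun t ht t' ht' ⟨d, hd⟩ ↦ ?_)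
  · exact mul_ne_zero (mul_ne_zero ha hp) (mul_ne_zero ht.2.1 ht.2.2) (hli _ _ _ h0).1
  · have hui := hu i
    have hvi := hv i
    simp only [map_add, map_smul, LinearMap.add_apply, LinearMap.smul_apply, smul_eq_mul,
      hx, hy, hz] at hui hvi ⊢
    linear_combination (p + t * a) * (q + t * b) * (r + t * c) *
      (p * q * r * hui + t * a * b * c * hvi)
  · obtain ⟨h1, h2, h3⟩ := hli
      (a * p * ((q + t' * b) * (r + t' * c)) - d * (a * p * ((q + t * b) * (r + t * c))))
      (b * q * ((p + t' * a) * (r + t' * c)) - d * (b * q * ((p + t * a) * (r + t * c))))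
      (c * r * ((p + t' * a) * (q + t' * b)) - d * (c * r * ((p + t * a) * (q + t * b))))
      (by rw [← sub_eq_zero.2 hd]; module)
    obtain ⟨ht1, ht2, ht3⟩ := ht
    obtain ⟨ht1', ht2', ht3'⟩ := ht'
    have e1 : (q + t' * b) * (r + t' * c) = d * ((q + t * b) * (r + t * c)) := by
      apply mul_left_cancel₀ (mul_ne_zero ha hp)
      linear_combination h1
    have e2 : (p + t' * a) * (r + t' * c) = d * ((p + t * a) * (r + t * c)) := by
      apply mul_left_cancel₀ (mul_ne_zero hb hq)
      linear_combination h2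
    have e3 : (p + t' * a) * (q + t' * b) = d * ((p + t * a) * (q + t * b)) := by
      apply mul_left_cancel₀ (mul_ne_zero hc hr)
      linear_combination h3
    have hpq : (p + t' * a) * (q + t * b) = (q + t' * b) * (p + t * a) := by
      apply mul_right_cancel₀ (mul_ne_zero ht3' ht3)
      linear_combination (q + t * b) * (r + t * c) * e2 - (p + t * a) * (r + t * c) * e1
    have hpr : (p + t' * a) * (r + t * c) = (r + t' * c) * (p + t * a) := by
      apply mul_right_cancel₀ (mul_ne_zero ht2' ht2)
      linear_combination (r + t * c) * (q + t * b) * e3 - (p + t * a) * (q + t * b) * e1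
    by_contra hne
    have hne' : t - t' ≠ 0 := sub_ne_zero.2 hne
    have f1 : p * b = q * a := mul_left_cancel₀ hne' (by linear_combination hpq)
    have f2 : p * c = r * a := mul_left_cancel₀ hne' (by linear_combination hpr)
    refine huv ⟨p / a, ?_⟩
    have g1 : q = p / a * b := by field_simp; linear_combination -f1
    have g2 : r = p / a * c := by field_simp; linear_combination -f2
    rw [smul_add, smul_add, smul_smul, smul_smul, smul_smul, ← g1, ← g2, div_mul_cancel₀ _ ha]

/-- If `Q₁, Q₂, Q₃ ∈ k[X,Y,Z,W]` are homogeneous of degree 2 over an infinite field and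
their common projective zeros are finite (i.e. the nonzero common zeros fall into finitely
many scalar-proportionality classes), then no five common projective zeros are coplanar:
there are no five pairwise non-proportional nonzero common zeros all lying in a common
3-dimensional linear subspace of `k⁴`. -/
theorem no_five_coplanar_basepoints {k : Type*} [Field k] [Infinite k]
    (Q₁ Q₂ Q₃ : MvPolynomial (Fin 4) k)
    (hQ₁ : Q₁.IsHomogeneous 2) (hQ₂ : Q₂.IsHomogeneous 2) (hQ₃ : Q₃.IsHomogeneous 2)
    (hfin : ∃ T : Finset (Fin 4 → k), ∀ v : Fin 4 → k, v ≠ 0 →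
      eval v Q₁ = 0 → eval v Q₂ = 0 → eval v Q₃ = 0 →
      ∃ u ∈ T, ∃ c : k, c ≠ 0 ∧ v = c • u) :
    ¬ ∃ v : Fin 5 → (Fin 4 → k),
        (∀ i, v i ≠ 0) ∧
        (∀ i, eval (v i) Q₁ = 0 ∧ eval (v i) Q₂ = 0 ∧ eval (v i) Q₃ = 0) ∧
        (∀ i j, i ≠ j → ¬ ∃ c : k, v j = c • v i) ∧
        ∃ W : Submodule k (Fin 4 → k), Module.finrank k W = 3 ∧ ∀ i, v i ∈ W := by
  rintro ⟨v, hv0, hvQ, hprop, W, hW, hvW⟩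
  obtain ⟨T, hT⟩ := hfin
  obtain ⟨B₁, hB₁⟩ := hQ₁.exists_bilinForm
  obtain ⟨B₂, hB₂⟩ := hQ₂.exists_bilinForm
  obtain ⟨B₃, hB₃⟩ := hQ₃.exists_bilinForm
  let B : Fin 3 → LinearMap.BilinForm k (Fin 4 → k) := ![B₁, B₂, B₃]
  have hB (x : Fin 4 → k) :
      (∀ i, B i x x = 0) ↔ eval x Q₁ = 0 ∧ eval x Q₂ = 0 ∧ eval x Q₃ = 0 := by
    simp [B, Fin.forall_fin_succ, hB₁, hB₂, hB₃]
  replace hT : ∀ x, x ≠ 0 → (∀ i, B i x x = 0) → ∃ u ∈ T, ∃ c : k, c ≠ 0 ∧ x = c • u :=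
    fun x hx h ↦ have h := (hB x).1 h; hT x hx h.1 h.2.1 h.2.2
  have hvB (j) : ∀ i, B i (v j) (v j) = 0 := (hB _).2 (hvQ j)
  have hpair (i j : Fin 5) (hij : i ≠ j) : LinearIndependent k ![v i, v j] :=
    (LinearIndependent.pair_iff' (hv0 i)).2 fun c hc ↦ hprop i j hij ⟨c, hc.symm⟩
  have hcol (i j l : Fin 5) (hij : i ≠ j) (hil : i ≠ l) (hjl : j ≠ l) (a b : k) :
      v l ≠ a • v i + b • v j :=
    fun h ↦ false_of_collinear_zeros hT (hvB i) (hvB j) (hvB l) (hpair i j hij)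
      (hprop i l hil) (hprop j l hjl) h
  have hli (r s t : k) (h : r • v 0 + s • v 1 + t • v 2 = 0) : r = 0 ∧ s = 0 ∧ t = 0 := by
    have ht : t = 0 := by
      by_contra ht
      refine hcol 0 1 2 (by decide) (by decide) (by decide) (-(t⁻¹ * r)) (-(t⁻¹ * s)) ?_
      rw [← one_smul k (v 2), ← inv_mul_cancel₀ ht, mul_smul, eq_neg_of_add_eq_zero_right h]
      module
    have := LinearIndependent.pair_iff.1 (hpair 0 1 (by decide)) r s (by simpa [ht] using h)
    exact ⟨this.1, this.2, ht⟩
  have hli' : LinearIndependent k ![v 0, v 1, v 2] := by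
    rw [Fintype.linearIndependent_iff]
    intro g hg
    simpa [Fin.forall_fin_succ] using hli (g 0) (g 1) (g 2) (by simpa [Fin.sum_univ_three] using hg)
  have hspan : Submodule.span k (Set.range ![v 0, v 1, v 2]) = W := by
    apply Submodule.eq_of_le_of_finrank_eq
    · rw [Submodule.span_le]
      rintro _ ⟨i, rfl⟩
      fin_cases i <;> exact hvW _
    · rw [finrank_span_eq_card hli', hW, Fintype.card_fin]
  have hcoord (j : Fin 5) : ∃ a b c : k, a • v 0 + b • v 1 + c • v 2 = v j := by
    have hj := hvW j
    rw [← hspan, Submodule.mem_span_range_iff_exists_fun] at hj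
    obtain ⟨g, hg⟩ := hj
    exact ⟨g 0, g 1, g 2, by simpa [Fin.sum_univ_three] using hg⟩
  have hcoord_ne (j : Fin 5) (h0 : 0 ≠ j) (h1 : 1 ≠ j) (h2 : 2 ≠ j) {a b c : k}
      (h : a • v 0 + b • v 1 + c • v 2 = v j) : a ≠ 0 ∧ b ≠ 0 ∧ c ≠ 0 := by
    refine ⟨?_, ?_, ?_⟩ <;> rintro rfl
    · exact hcol 1 2 j (by decide) h1 h2 b c (by simp [← h])
    · exact hcol 0 2 j (by decide) h0 h2 a c (by simp [← h])
    · exact hcol 0 1 j (by decide) h0 h1 a b (by simp [← h])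
  obtain ⟨a, b, c, h3⟩ := hcoord 3
  obtain ⟨p, q, r, h4⟩ := hcoord 4
  obtain ⟨ha, hb, hc⟩ := hcoord_ne 3 (by decide) (by decide) (by decide) h3
  obtain ⟨hp, hq, hr⟩ := hcoord_ne 4 (by decide) (by decide) (by decide) h4
  refine false_of_five_general_zeros hT (hvB 0) (hvB 1) (hvB 2) hli ha hb hc hp hq hr ?_ ?_ ?_
  · rw [h3]; exact hvB 3
  · rw [h4]; exact hvB 4
  · rw [h3, h4]; exact hprop 3 4 (by decide)
end

section
/- Let S be a set with 8 elements and let F be a family of 14 distinct 4-element subsets of S which is closed under complementation (if A ∈ F then S ∖ A ∈ F) and such that any two distinct members of F intersect in at most 2 elements. Then every 2-element subset of S is contained in exactly 3 members of F. -/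
open Finset in
/-- Members of a family with pairwise intersections of size at most `#P` that all contain `P`
are pairwise disjoint outside `P`, so they number at most `#Pᶜ / (k - #P)`. -/
theorem card_filter_superset_mul_le {α : Type*} [Fintype α] [DecidableEq α]
    {F : Finset (Finset α)} {k : ℕ} {P : Finset α} (hk : ∀ A ∈ F, #A = k)
    (hint : ∀ A ∈ F, ∀ B ∈ F, A ≠ B → #(A ∩ B) ≤ #P) :
    #{A ∈ F | P ⊆ A} * (k - #P) ≤ #Pᶜ := by
  have hdisj : (({A ∈ F | P ⊆ A} : Finset (Finset α)) : Set (Finset α)).PairwiseDisjoint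
      (· \ P) := by
    intro A hA B hB hne
    rw [mem_coe, mem_filter] at hA hB
    have hAB : P = A ∩ B :=
      eq_of_subset_of_card_le (subset_inter hA.2 hB.2) (hint A hA.1 B hB.1 hne)
    rw [Function.onFun, disjoint_left]
    intro x hxA hxB
    rw [mem_sdiff] at hxA hxB
    exact hxA.2 (hAB ▸ mem_inter.2 ⟨hxA.1, hxB.1⟩)
  calc #{A ∈ F | P ⊆ A} * (k - #P)
      = ∑ A ∈ F with P ⊆ A, #(A \ P) := by
        refine (sum_const_nat fun A hA => ?_).symm
        rw [mem_filter] at hA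
        rw [card_sdiff_of_subset hA.2, hk A hA.1]
    _ = #({A ∈ F | P ⊆ A}.biUnion (· \ P)) := (card_biUnion hdisj).symm
    _ ≤ #Pᶜ := by
        refine card_le_card (biUnion_subset.2 fun A _ x hx => ?_)
        exact mem_compl.2 (mem_sdiff.1 hx).2

open Finset in
/-- Double counting of incidences between `m`-subsets and the members of a family of
`k`-subsets. -/
theorem sum_card_filter_superset {α : Type*} [Fintype α] [DecidableEq α]
    {F : Finset (Finset α)} {k : ℕ} (m : ℕ) (hk : ∀ A ∈ F, #A = k) :
    ∑ P ∈ powersetCard m univ, #{A ∈ F | P ⊆ A} = #F * k.choose m := by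
  refine (sum_card_bipartiteAbove_eq_sum_card_bipartiteBelow
    (fun P A : Finset α => P ⊆ A)).trans
    (sum_const_nat (m := k.choose m) fun A hA => ?_)
  rw [← hk A hA, ← card_powersetCard]
  congr 1
  ext P
  simp [bipartiteBelow, mem_powersetCard, and_comm]


/-- Let `S` be a set with 8 elements (modeled as a finite type `α` of cardinality 8) and
`F` a family of 14 distinct 4-element subsets, closed under complementation, any two
distinct members of which meet in at most 2 elements. Then every 2-element subset of `S`
is contained in exactly 3 members of `F`. -/
theorem pair_in_exactly_three_quadruples
    {α : Type*} [Fintype α] [DecidableEq α] (hcard : Fintype.card α = 8)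
    (F : Finset (Finset α)) (hFcard : F.card = 14)
    (h4 : ∀ A ∈ F, A.card = 4)
    (hcompl : ∀ A ∈ F, Aᶜ ∈ F)
    (hint : ∀ A ∈ F, ∀ B ∈ F, A ≠ B → (A ∩ B).card ≤ 2)
    (P : Finset α) (hP : P.card = 2) :
    (F.filter fun A => P ⊆ A).card = 3 := by
  have hle : ∀ Q ∈ Finset.powersetCard 2 (Finset.univ : Finset α),
      (F.filter fun A => Q ⊆ A).card ≤ 3 := by
    intro Q hQ
    have hQ2 := (Finset.mem_powersetCard.1 hQ).2
    have := card_filter_superset_mul_le (P := Q) h4 (by rwa [hQ2])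
    rw [Finset.card_compl, hcard, hQ2] at this
    omega
  have hsum : ∑ Q ∈ Finset.powersetCard 2 (Finset.univ : Finset α),
      (F.filter fun A => Q ⊆ A).card = ∑ Q ∈ Finset.powersetCard 2 (Finset.univ : Finset α), 3 := by
    rw [sum_card_filter_superset 2 h4, hFcard, Finset.sum_const, Finset.card_powersetCard,
      Finset.card_univ, hcard]
    decide
  exact (Finset.sum_eq_sum_iff_of_le hle).1 hsum P
    (Finset.mem_powersetCard.2 ⟨P.subset_univ, hP⟩)
end

section
/- Let S be a set with 8 elements and let F be a family of 14 distinct 4-element subsets of S which is closed under complementation (if A ∈ F then S ∖ A ∈ F) and such that any two distinct members of F intersect in at most 2 elements. Then every 3-element subset of S is contained in exactly one member of F. -/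
/-- Let `S` be a set with 8 elements (modeled as a finite type `α` of cardinality 8) and
`F` a family of 14 distinct 4-element subsets, closed under complementation, any two
distinct members of which meet in at most 2 elements. Then every 3-element subset of `S`
is contained in exactly one member of `F`. -/
theorem triple_in_exactly_one_quadruple
    {α : Type*} [Fintype α] [DecidableEq α] (hcard : Fintype.card α = 8)
    (F : Finset (Finset α)) (hFcard : F.card = 14)
    (h4 : ∀ A ∈ F, A.card = 4)
    (hcompl : ∀ A ∈ F, Aᶜ ∈ F)
    (hint : ∀ A ∈ F, ∀ B ∈ F, A ≠ B → (A ∩ B).card ≤ 2)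
    (P : Finset α) (hP : P.card = 3) :
    (F.filter fun A => P ⊆ A).card = 1 := by
  have hdisj : (F : Set (Finset α)).PairwiseDisjoint (Finset.powersetCard 3) := by
    intro A hA B hB hAB
    refine Finset.disjoint_left.2 fun Q hQA hQB => ?_
    rw [Finset.mem_powersetCard] at hQA hQB
    have hQ := Finset.card_le_card (Finset.subset_inter hQA.1 hQB.1)
    have := hint A hA B hB hAB
    omega
  have hcover : F.biUnion (Finset.powersetCard 3) = Finset.powersetCard 3 Finset.univ := by
    refine Finset.eq_of_subset_of_card_le ?_ ?_
    · intro Q hQ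
      obtain ⟨A, -, hQA⟩ := Finset.mem_biUnion.1 hQ
      exact Finset.mem_powersetCard.2
        ⟨Finset.subset_univ Q, (Finset.mem_powersetCard.1 hQA).2⟩
    · have hsum : ∑ A ∈ F, (Finset.powersetCard 3 A).card = ∑ _A ∈ F, 4 :=
        Finset.sum_congr rfl fun A hA => by
          rw [Finset.card_powersetCard, h4 A hA]; rfl
      rw [Finset.card_biUnion hdisj, hsum, Finset.sum_const, hFcard,
        Finset.card_powersetCard, Finset.card_univ, hcard]
      decide
  have hPmem : P ∈ F.biUnion (Finset.powersetCard 3) :=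
    hcover ▸ Finset.mem_powersetCard.2 ⟨Finset.subset_univ P, hP⟩
  obtain ⟨A, hA, hPA⟩ := Finset.mem_biUnion.1 hPmem
  refine Finset.card_eq_one.2 ⟨A, Finset.eq_singleton_iff_unique_mem.2
    ⟨Finset.mem_filter.2 ⟨hA, (Finset.mem_powersetCard.1 hPA).1⟩, fun B hB => ?_⟩⟩
  obtain ⟨hBF, hPB⟩ := Finset.mem_filter.1 hB
  exact hdisj.elim_finset hBF hA P (Finset.mem_powersetCard.2 ⟨hPB, hP⟩) hPA
end

section
/- Let S be a set with 8 elements and let F be a family of 14 distinct 4-element subsets of S which is closed under complementation (if A ∈ F then S ∖ A ∈ F) and such that any two distinct members of F intersect in at most 2 elements. Then there is a bijection σ : S → {1,…,8} carrying F onto the family F₀. -/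
/-- The family `F₀` of fourteen 4-element subsets of `{1,…,8}` (modeled as `Fin 8`,
with `i : Fin 8` corresponding to `i+1`):
{1,2,3,4}, {5,6,7,8}, {1,2,5,6}, {3,4,7,8}, {1,2,7,8}, {3,4,5,6}, {1,3,5,7},
{2,4,6,8}, {1,3,6,8}, {2,4,5,7}, {1,4,5,8}, {2,3,6,7}, {1,4,6,7}, {2,3,5,8}. -/
def F₀ : Finset (Finset (Fin 8)) :=
  { {0, 1, 2, 3}, {4, 5, 6, 7}, {0, 1, 4, 5}, {2, 3, 6, 7}, {0, 1, 6, 7}, {2, 3, 4, 5},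
    {0, 2, 4, 6}, {1, 3, 5, 7}, {0, 2, 5, 7}, {1, 3, 4, 6}, {0, 3, 4, 7}, {1, 2, 5, 6},
    {0, 3, 5, 6}, {1, 2, 4, 7} }

/-- A family of fourteen 4-subsets of an 8-set meeting pairwise in at most two points
covers every triple: it is a Steiner quadruple system. -/
theorem exists_insert_mem_of_card_eq_three {α : Type*} [Fintype α] [DecidableEq α]
    (hcard : Fintype.card α = 8) {F : Finset (Finset α)} (hFcard : F.card = 14)
    (h4 : ∀ A ∈ F, A.card = 4)
    (hint : ∀ A ∈ F, ∀ B ∈ F, A ≠ B → (A ∩ B).card ≤ 2) {T : Finset α} (hT : T.card = 3) :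
    ∃ d, d ∉ T ∧ insert d T ∈ F := by
  have hdisj : (F : Set (Finset α)).PairwiseDisjoint (Finset.powersetCard 3) := by
    intro A hA B hB hAB
    refine Finset.disjoint_left.2 fun U hUA hUB => ?_
    rw [Finset.mem_powersetCard] at hUA hUB
    have h₁ := Finset.card_le_card (Finset.subset_inter hUA.1 hUB.1)
    have h₂ := hint A hA B hB hAB
    omega
  have hunion : F.biUnion (Finset.powersetCard 3) = Finset.univ.powersetCard 3 := by
    refine Finset.eq_of_subset_of_card_le (Finset.biUnion_subset.2 fun A _ =>
      Finset.powersetCard_mono (Finset.subset_univ A)) ?_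
    have hsum : ∑ A ∈ F, (A.powersetCard 3).card = ∑ _A ∈ F, 4 :=
      Finset.sum_congr rfl fun A hA => by rw [Finset.card_powersetCard, h4 A hA]; rfl
    rw [Finset.card_biUnion hdisj, hsum, Finset.sum_const, hFcard, Finset.card_powersetCard,
      Finset.card_univ, hcard]
    decide
  have hmem : T ∈ F.biUnion (Finset.powersetCard 3) := by
    rw [hunion]
    exact Finset.mem_powersetCard.2 ⟨Finset.subset_univ T, hT⟩
  obtain ⟨A, hA, hTA⟩ := Finset.mem_biUnion.1 hmem
  obtain ⟨d, hd, rfl⟩ := Finset.exists_eq_insert_iff.2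
    ⟨(Finset.mem_powersetCard.1 hTA).1, by rw [h4 A hA, hT]⟩
  exact ⟨d, hd, hA⟩

/-- A Steiner quadruple system on `Fin 8` that is closed under complementation and contains
`{0, 1, 2, 3}`, `{0, 1, 4, 5}` and `{0, 2, 4, 6}` contains all of `F₀`. -/
theorem F₀_subset_of_mem {G : Set (Finset (Fin 8))} (hcompl : ∀ A ∈ G, Aᶜ ∈ G)
    (hint : ∀ A ∈ G, ∀ B ∈ G, A ≠ B → (A ∩ B).card ≤ 2)
    (hcover : ∀ T : Finset (Fin 8), T.card = 3 → ∃ d, d ∉ T ∧ insert d T ∈ G)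
    (h0123 : ({0, 1, 2, 3} : Finset (Fin 8)) ∈ G)
    (h0145 : ({0, 1, 4, 5} : Finset (Fin 8)) ∈ G)
    (h0246 : ({0, 2, 4, 6} : Finset (Fin 8)) ∈ G) :
    ∀ A ∈ F₀, A ∈ G := by
  have hne : ∀ {A B : Finset (Fin 8)}, A ∈ G → B ∈ G → ¬ (A ≠ B ∧ 2 < (A ∩ B).card) :=
    fun {A B} hA hB h => (hint A hA B hB h.1).not_gt h.2
  have h0347 : ({0, 3, 4, 7} : Finset (Fin 8)) ∈ G := by
    obtain ⟨d, hd, hG⟩ := hcover {0, 3, 4} (by decide)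
    have h₁ := hne h0123 hG
    have h₂ := hne h0145 hG
    have h₃ := hne h0246 hG
    obtain rfl : d = 7 := by clear hG; revert d; decide
    exact (by decide : insert 7 {0, 3, 4} = ({0, 3, 4, 7} : Finset (Fin 8))) ▸ hG
  have h0167 : ({0, 1, 6, 7} : Finset (Fin 8)) ∈ G := by
    obtain ⟨d, hd, hG⟩ := hcover {0, 1, 6} (by decide)
    have h₁ := hne h0123 hG
    have h₂ := hne h0145 hG
    obtain rfl : d = 7 := by clear hG; revert d; decide
    exact (by decide : insert 7 {0, 1, 6} = ({0, 1, 6, 7} : Finset (Fin 8))) ▸ hG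
  have h0257 : ({0, 2, 5, 7} : Finset (Fin 8)) ∈ G := by
    obtain ⟨d, hd, hG⟩ := hcover {0, 2, 5} (by decide)
    have h₁ := hne h0123 hG
    have h₂ := hne h0145 hG
    have h₃ := hne h0246 hG
    obtain rfl : d = 7 := by clear hG; revert d; decide
    exact (by decide : insert 7 {0, 2, 5} = ({0, 2, 5, 7} : Finset (Fin 8))) ▸ hG
  have h0356 : ({0, 3, 5, 6} : Finset (Fin 8)) ∈ G := by
    obtain ⟨d, hd, hG⟩ := hcover {0, 3, 5} (by decide)
    have h₁ := hne h0123 hG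
    have h₂ := hne h0145 hG
    have h₃ := hne h0347 hG
    obtain rfl : d = 6 := by clear hG; revert d; decide
    exact (by decide : insert 6 {0, 3, 5} = ({0, 3, 5, 6} : Finset (Fin 8))) ▸ hG
  have hc : ∀ {A B : Finset (Fin 8)}, A ∈ G → Aᶜ = B → B ∈ G := fun hA h => h ▸ hcompl _ hA
  simp only [F₀, Finset.forall_mem_insert, Finset.mem_singleton, forall_eq]
  exact ⟨h0123, hc h0123 (by decide), h0145, hc h0145 (by decide), h0167, hc h0167 (by decide),
    h0246, hc h0246 (by decide), h0257, hc h0257 (by decide), h0347, hc h0347 (by decide),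
    h0356, hc h0356 (by decide)⟩

/-- The points of an 8-set carrying a Steiner quadruple system can be labelled so that three
prescribed blocks of `F₀` occur. -/
theorem exists_equiv_image_mem {α : Type*} [Fintype α] [DecidableEq α]
    (hcard : Fintype.card α = 8) {F : Finset (Finset α)} (hne : F.Nonempty)
    (h4 : ∀ A ∈ F, A.card = 4)
    (hint : ∀ A ∈ F, ∀ B ∈ F, A ≠ B → (A ∩ B).card ≤ 2)
    (hcover : ∀ T : Finset α, T.card = 3 → ∃ d, d ∉ T ∧ insert d T ∈ F) :
    ∃ e : Fin 8 ≃ α, Finset.image e {0, 1, 2, 3} ∈ F ∧ Finset.image e {0, 1, 4, 5} ∈ F ∧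
      Finset.image e {0, 2, 4, 6} ∈ F := by
  have hno : ∀ {A B T : Finset α}, A ∈ F → B ∈ F → T.card = 3 → T ⊆ A → T ⊆ B → A = B := by
    intro A B T hA hB hT hTA hTB
    by_contra hAB
    have h₁ := Finset.card_le_card (Finset.subset_inter hTA hTB)
    have h₂ := hint A hA B hB hAB
    omega
  have hnew : ∀ T : Finset α, T.card < 8 → ∃ x, x ∉ T := fun T hT => by
    by_contra! h
    have := Finset.card_univ (α := α)
    rw [← Finset.eq_univ_iff_forall.2 h] at this
    omega
  obtain ⟨A, hA⟩ := hne
  obtain ⟨x₀, T, hx₀, rfl, hT⟩ := Finset.card_eq_succ.1 (h4 A hA)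
  obtain ⟨x₁, x₂, x₃, h12, h13, h23, rfl⟩ := Finset.card_eq_three.1 hT
  simp only [Finset.mem_insert, Finset.mem_singleton, not_or] at hx₀
  obtain ⟨h01, h02, h03⟩ := hx₀
  obtain ⟨x₄, hx₄⟩ := hnew {x₀, x₁, x₂, x₃} (by rw [h4 _ hA]; norm_num)
  have h₄ := hx₄
  simp only [Finset.mem_insert, Finset.mem_singleton, not_or] at h₄
  obtain ⟨h40, h41, h42, h43⟩ := h₄
  have c014 : ({x₀, x₁, x₄} : Finset α).card = 3 :=
    Finset.card_eq_three.2 ⟨_, _, _, h01, Ne.symm h40, Ne.symm h41, rfl⟩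
  have c024 : ({x₀, x₂, x₄} : Finset α).card = 3 :=
    Finset.card_eq_three.2 ⟨_, _, _, h02, Ne.symm h40, Ne.symm h42, rfl⟩
  obtain ⟨x₅, hx₅, h5⟩ := hcover _ c014
  obtain ⟨x₆, hx₆, h6⟩ := hcover _ c024
  simp only [Finset.mem_insert, Finset.mem_singleton, not_or] at hx₅ hx₆
  have c012 : ({x₀, x₁, x₂} : Finset α).card = 3 :=
    Finset.card_eq_three.2 ⟨_, _, _, h01, h02, h12, rfl⟩
  have c013 : ({x₀, x₁, x₃} : Finset α).card = 3 :=
    Finset.card_eq_three.2 ⟨_, _, _, h01, h03, h13, rfl⟩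
  have c023 : ({x₀, x₂, x₃} : Finset α).card = 3 :=
    Finset.card_eq_three.2 ⟨_, _, _, h02, h03, h23, rfl⟩
  have h52 : x₅ ≠ x₂ := by
    rintro rfl
    exact hx₄ (hno hA h5 c012 (by simp [Finset.insert_subset_iff])
      (by simp [Finset.insert_subset_iff]) ▸ by simp)
  have h53 : x₅ ≠ x₃ := by
    rintro rfl
    exact hx₄ (hno hA h5 c013 (by simp [Finset.insert_subset_iff])
      (by simp [Finset.insert_subset_iff]) ▸ by simp)
  have h61 : x₆ ≠ x₁ := by
    rintro rfl
    exact hx₄ (hno hA h6 c012 (by simp [Finset.insert_subset_iff])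
      (by simp [Finset.insert_subset_iff]) ▸ by simp)
  have h63 : x₆ ≠ x₃ := by
    rintro rfl
    exact hx₄ (hno hA h6 c023 (by simp [Finset.insert_subset_iff])
      (by simp [Finset.insert_subset_iff]) ▸ by simp)
  have h65 : x₆ ≠ x₅ := by
    rintro rfl
    have c046 : ({x₀, x₄, x₆} : Finset α).card = 3 :=
      Finset.card_eq_three.2 ⟨_, _, _, Ne.symm h40, Ne.symm hx₆.1, Ne.symm hx₆.2.2, rfl⟩
    have heq := hno h5 h6 c046 (by simp [Finset.insert_subset_iff])
      (by simp [Finset.insert_subset_iff])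
    have hmem : x₁ ∈ ({x₆, x₀, x₂, x₄} : Finset α) := by
      rw [← heq]
      simp
    simp only [Finset.mem_insert, Finset.mem_singleton] at hmem
    tauto
  obtain ⟨x₇, hx₇⟩ := hnew {x₀, x₁, x₂, x₃, x₄, x₅, x₆}
    ((Finset.card_insert_le _ _).trans_lt
      (Nat.lt_succ_of_le (Nat.succ_le_succ Finset.card_le_six)))
  simp only [Finset.mem_insert, Finset.mem_singleton, not_or] at hx₇
  have hinj : Function.Injective ![x₀, x₁, x₂, x₃, x₄, x₅, x₆, x₇] := by
    rw [← List.nodup_ofFn]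
    simp
    grind
  refine ⟨Equiv.ofBijective _ ((Fintype.bijective_iff_injective_and_card _).2
    ⟨hinj, by simp [hcard]⟩), ?_, ?_, ?_⟩
  · simpa [Finset.image_insert] using hA
  · convert h5 using 1
    ext y
    simp only [Finset.image_insert, Finset.image_singleton, Equiv.ofBijective_apply,
      Finset.mem_insert, Finset.mem_singleton]
    change (y = x₀ ∨ y = x₁ ∨ y = x₄ ∨ y = x₅) ↔ _
    clear * -
    tauto
  · convert h6 using 1
    ext y
    simp only [Finset.image_insert, Finset.image_singleton, Equiv.ofBijective_apply,
      Finset.mem_insert, Finset.mem_singleton]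
    change (y = x₀ ∨ y = x₂ ∨ y = x₄ ∨ y = x₆) ↔ _
    clear * -
    tauto

/-- Let `S` be a set with 8 elements (modeled as a finite type `α` of cardinality 8) and
`F` a family of 14 distinct 4-element subsets, closed under complementation, any two
distinct members of which meet in at most 2 elements. Then some bijection
`σ : S → {1,…,8}` carries `F` onto the family `F₀`. -/
theorem quadruple_family_unique_up_to_bijection
    {α : Type*} [Fintype α] [DecidableEq α] (hcard : Fintype.card α = 8)
    (F : Finset (Finset α)) (hFcard : F.card = 14)
    (h4 : ∀ A ∈ F, A.card = 4)
    (hcompl : ∀ A ∈ F, Aᶜ ∈ F)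
    (hint : ∀ A ∈ F, ∀ B ∈ F, A ≠ B → (A ∩ B).card ≤ 2) :
    ∃ σ : α ≃ Fin 8, F.image (fun A => A.image σ) = F₀ := by
  have hcover := fun T : Finset α =>
    exists_insert_mem_of_card_eq_three hcard hFcard h4 hint (T := T)
  obtain ⟨e, h0123, h0145, h0246⟩ := exists_equiv_image_mem hcard
    (Finset.card_pos.1 (by omega)) h4 hint hcover
  have himg : ∀ A : Finset (Fin 8), (A.image e).image e.symm = A := fun A => by
    simp [Finset.image_image]
  have hsub : ∀ A ∈ F₀, A.image e ∈ F := by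
    refine F₀_subset_of_mem (G := {A | A.image e ∈ F}) (fun A hA => ?_) (fun A hA B hB hAB => ?_)
      (fun T hT => ?_) h0123 h0145 h0246
    · rw [Set.mem_ofPred_eq, Finset.compl_eq_univ_sdiff, Finset.image_sdiff _ _ e.injective,
        Finset.image_univ_equiv, ← Finset.compl_eq_univ_sdiff]
      exact hcompl _ hA
    · rw [← Finset.card_image_of_injective _ e.injective, Finset.image_inter _ _ e.injective]
      exact hint _ hA _ hB (Finset.image_injective e.injective |>.ne hAB)
    · obtain ⟨d, hd, hF⟩ := hcover (T.image e)
        (by rw [Finset.card_image_of_injective _ e.injective, hT])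
      refine ⟨e.symm d, fun h => hd (Finset.mem_image.2 ⟨_, h, e.apply_symm_apply d⟩), ?_⟩
      rw [Set.mem_ofPred_eq, Finset.image_insert, e.apply_symm_apply]
      exact hF
  refine ⟨e.symm, (Finset.eq_of_subset_of_card_le (fun A hA =>
    Finset.mem_image.2 ⟨_, hsub A hA, himg A⟩) ?_).symm⟩
  exact (Finset.card_image_le.trans_eq hFcard).trans (by decide)
end

section
/- Let k be a field and let v₁,…,v₈ ∈ k⁴ be nonzero vectors such that any three of them are linearly independent, the four vectors v₁, v₂, v₃, v₅ are linearly independent, and for every set S in the family F₀, the four vectors {vᵢ : i ∈ S} are linearly dependent. Then k has characteristic 2, i.e. (2 : k) = 0. -/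
section Coplanarity

variable {k V ι κ : Type*} [Field k] [AddCommGroup V] [Module k V]

/-- A family indexed by `κ` that covers a set of indices is independent only if the subfamily
on that set is. -/
theorem LinearIndependent.subtype_of_cover {v : ι → V} {f : κ → ι}
    (h : LinearIndependent k (v ∘ f)) {S : Finset ι} (hS : ∀ x ∈ S, ∃ m, f m = x) :
    LinearIndependent k (fun i : {x : ι // x ∈ S} => v i.1) := by
  choose e he using fun x : {x : ι // x ∈ S} => hS x.1 x.2
  have hinj : Function.Injective e := fun x y hxy => by
    apply Subtype.ext
    rw [← he x, ← he y, hxy]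
  simpa [Function.comp_def, he] using h.comp e hinj

/-- The coordinates of a vector with respect to four independent vectors are unique. -/
theorem LinearIndependent.coords_eq_of_four {a b c d : V}
    (h : LinearIndependent k ![a, b, c, d]) {x y z w x' y' z' w' : k}
    (e : x • a + y • b + z • c + w • d = x' • a + y' • b + z' • c + w' • d) :
    x = x' ∧ y = y' ∧ z = z' ∧ w = w' := by
  have h0 := Fintype.linearIndependent_iff.1 h ![x - x', y - y', z - z', w - w'] (by
    simp only [Fin.sum_univ_four, Matrix.cons_val]
    linear_combination (norm := module) e)
  exact ⟨sub_eq_zero.1 (h0 0), sub_eq_zero.1 (h0 1), sub_eq_zero.1 (h0 2), sub_eq_zero.1 (h0 3)⟩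

/-- The third of three independent vectors is not a combination of the first two. -/
theorem LinearIndependent.ne_combination_of_three {a b c : V}
    (h : LinearIndependent k ![a, b, c]) (x y : k) : c ≠ x • a + y • b := by
  intro e
  have h0 := Fintype.linearIndependent_iff.1 h ![x, y, -1] (by
    simp only [Fin.sum_univ_three, Matrix.cons_val, e]
    module) 2
  simp at h0

/-- If three of four dependent vectors are independent, the fourth is a combination of them. -/
theorem LinearIndependent.exists_combination_of_three {a b c d : V}
    (h : LinearIndependent k ![a, b, c]) (hd : ¬ LinearIndependent k ![a, b, c, d]) :
    ∃ x y z : k, d = x • a + y • b + z • c := by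
  rw [Fintype.not_linearIndependent_iff] at hd
  obtain ⟨g, hg, hne⟩ := hd
  simp only [Fin.sum_univ_four, Matrix.cons_val] at hg
  have h3 : g 3 ≠ 0 := by
    intro h3
    have h0 := Fintype.linearIndependent_iff.1 h ![g 0, g 1, g 2] (by
      simpa [Fin.sum_univ_three, h3] using hg)
    obtain ⟨i, hi⟩ := hne
    fin_cases i
    · exact hi (h0 0)
    · exact hi (h0 1)
    · exact hi (h0 2)
    · exact hi h3
  refine ⟨-(g 0 / g 3), -(g 1 / g 3), -(g 2 / g 3), ?_⟩
  have hd' : g 3 • d = g 3 • (-(g 0 / g 3) • a + -(g 1 / g 3) • b + -(g 2 / g 3) • c) := by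
    simp only [smul_add, smul_smul, mul_neg, mul_div_cancel₀ _ h3]
    linear_combination (norm := module) hg
  exact smul_right_injective V h3 hd'

end Coplanarity

/-- If `v₁,…,v₈ ∈ k⁴` are nonzero vectors with any three of them linearly independent,
`v₁, v₂, v₃, v₅` linearly independent, and `{vᵢ : i ∈ S}` linearly dependent for every
`S ∈ F₀`, then `k` has characteristic 2. -/
theorem char_two_of_coplanarity_pattern {k : Type*} [Field k]
    (v : Fin 8 → Fin 4 → k) (hne : ∀ i, v i ≠ 0)
    (h3 : ∀ i j l : Fin 8, i ≠ j → i ≠ l → j ≠ l → LinearIndependent k ![v i, v j, v l])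
    (h4 : LinearIndependent k ![v 0, v 1, v 2, v 4])
    (hdep : ∀ S ∈ F₀, ¬ LinearIndependent k (fun i : {x : Fin 8 // x ∈ S} => v i.1)) :
    (2 : k) = 0 := by
  have dependent (f : Fin 4 → Fin 8) (hf : Finset.univ.image f ∈ F₀) :
      ¬ LinearIndependent k (v ∘ f) := fun h =>
    hdep _ hf (h.subtype_of_cover fun x hx => by simpa using hx)
  have comb (i j l m : Fin 8) (hij : i ≠ j) (hil : i ≠ l) (hjl : j ≠ l)
      (hf : Finset.univ.image ![i, j, l, m] ∈ F₀) :
      ∃ x y z : k, v m = x • v i + y • v j + z • v l :=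
    (h3 i j l hij hil hjl).exists_combination_of_three (by
      have := dependent _ hf
      rwa [show v ∘ ![i, j, l, m] = ![v i, v j, v l, v m] by
        ext n; fin_cases n <;> rfl] at this)
  obtain ⟨a, b, c, e3⟩ := comb 0 1 2 3 (by decide) (by decide) (by decide) (by decide)
  obtain ⟨d, e, f, e5⟩ := comb 0 1 4 5 (by decide) (by decide) (by decide) (by decide)
  obtain ⟨g, h, i, e6⟩ := comb 0 2 4 6 (by decide) (by decide) (by decide) (by decide)
  obtain ⟨x₁, y₁, γ, r₁⟩ := comb 1 2 5 6 (by decide) (by decide) (by decide) (by decide)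
  obtain ⟨x₂, α, z₂, r₂⟩ := comb 2 3 4 5 (by decide) (by decide) (by decide) (by decide)
  obtain ⟨x₃, β, z₃, r₃⟩ := comb 1 3 4 6 (by decide) (by decide) (by decide) (by decide)
  obtain ⟨x₄, y, z, r₄⟩ := comb 0 3 5 6 (by decide) (by decide) (by decide) (by decide)
  have ha : a ≠ 0 := by
    rintro rfl
    exact (h3 1 2 3 (by decide) (by decide) (by decide)).ne_combination_of_three b c
      (by simpa using e3)
  have hb : b ≠ 0 := by
    rintro rfl
    exact (h3 0 2 3 (by decide) (by decide) (by decide)).ne_combination_of_three a c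
      (by simpa using e3)
  have hc : c ≠ 0 := by
    rintro rfl
    exact (h3 0 1 3 (by decide) (by decide) (by decide)).ne_combination_of_three a b
      (by simpa using e3)
  have hf : f ≠ 0 := by
    rintro rfl
    exact (h3 0 1 5 (by decide) (by decide) (by decide)).ne_combination_of_three d e
      (by simpa using e5)
  have hβ : β ≠ 0 := by
    rintro rfl
    exact (h3 1 4 6 (by decide) (by decide) (by decide)).ne_combination_of_three x₃ z₃
      (by simpa using r₃)
  rw [e6, e5] at r₁
  rw [e5, e3] at r₂
  rw [e6, e3] at r₃
  rw [e6, e3, e5] at r₄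
  obtain ⟨p₁, -, -, s₁⟩ := h4.coords_eq_of_four (x := g) (y := 0) (z := h) (w := i)
    (x' := γ * d) (y' := x₁ + γ * e) (z' := y₁) (w' := γ * f)
    (by linear_combination (norm := module) r₁)
  obtain ⟨p₂, q₂, -, -⟩ := h4.coords_eq_of_four (x := d) (y := e) (z := 0) (w := f)
    (x' := α * a) (y' := α * b) (z' := x₂ + α * c) (w' := z₂)
    (by linear_combination (norm := module) r₂)
  obtain ⟨p₃, -, t₃, -⟩ := h4.coords_eq_of_four (x := g) (y := 0) (z := h) (w := i)
    (x' := β * a) (y' := x₃ + β * b) (z' := β * c) (w' := z₃)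
    (by linear_combination (norm := module) r₃)
  obtain ⟨-, q₄, t₄, s₄⟩ := h4.coords_eq_of_four (x := g) (y := 0) (z := h) (w := i)
    (x' := x₄ + y * a + z * d) (y' := y * b + z * e) (z' := y * c) (w' := z * f)
    (by linear_combination (norm := module) r₄)
  have hy : y = β := mul_right_cancel₀ hc (t₄.symm.trans t₃)
  have hz : z = γ := mul_right_cancel₀ hf (s₄.symm.trans s₁)
  have hβγ : β = γ * α := mul_right_cancel₀ ha (by linear_combination p₁ - p₃ + γ * p₂)
  have h2 : 2 * (β * b) = 0 := by
    subst hy hz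
    linear_combination -q₄ - z * q₂ + b * hβγ
  exact (mul_eq_zero.1 h2).resolve_right (mul_ne_zero hβ hb)
end

section
/- Let k be a field of characteristic 2 and let p₁=(1,0,0,0), p₂=(0,1,0,0), p₃=(0,0,1,0), p₄=(1,1,1,0), p₅=(0,0,0,1), p₆=(1,1,0,1), p₇=(1,0,1,1), p₈=(0,1,1,1) in k⁴. Then any three of the vectors p₁,…,p₈ are linearly independent, and for every set S in the family F₀ the four vectors {pᵢ : i ∈ S} are linearly dependent. -/
/-- The 8 standard points `p₁ = (1,0,0,0), p₂ = (0,1,0,0), p₃ = (0,0,1,0), p₄ = (1,1,1,0),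
p₅ = (0,0,0,1), p₆ = (1,1,0,1), p₇ = (1,0,1,1), p₈ = (0,1,1,1)` in `k⁴`. -/
def stdPts (k : Type*) [Field k] : Fin 8 → Fin 4 → k :=
  ![![1, 0, 0, 0], ![0, 1, 0, 0], ![0, 0, 1, 0], ![1, 1, 1, 0],
    ![0, 0, 0, 1], ![1, 1, 0, 1], ![1, 0, 1, 1], ![0, 1, 1, 1]]

/-- The standard points over a field extension are the images of the standard points. -/
theorem stdPts_map {k L : Type*} [Field k] [Field L] (f : k →+* L) (i : Fin 8) (a : Fin 4) :
    stdPts L i a = f (stdPts k i a) := by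
  fin_cases i <;> fin_cases a <;> simp [stdPts]

/-- Three distinct standard points over the prime field have a nonvanishing maximal minor. -/
theorem exists_minor_stdPts_ne_zero : ∀ i j l : Fin 8, i ≠ j → i ≠ l → j ≠ l →
    ∃ c : Fin 4, (Matrix.of fun r s => ![stdPts (ZMod 2) i, stdPts (ZMod 2) j,
      stdPts (ZMod 2) l] r (c.succAbove s)).det ≠ 0 := by
  simp only [Matrix.det_fin_three]
  decide +kernel

/-- The four points of each member of `F₀` sum to zero over the prime field. -/
theorem sum_stdPts_eq_zero : ∀ S ∈ F₀, ∀ a : Fin 4, ∑ i ∈ S, stdPts (ZMod 2) i a = 0 := by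
  decide +kernel

/-- Over a field of characteristic 2, any three of the standard points `p₁,…,p₈` are
linearly independent, and for each `S ∈ F₀` the four points `{pᵢ : i ∈ S}` are linearly
dependent. -/
theorem std_points_realize_coplanarity_pattern {k : Type*} [Field k] [CharP k 2] :
    (∀ i j l : Fin 8, i ≠ j → i ≠ l → j ≠ l →
      LinearIndependent k ![stdPts k i, stdPts k j, stdPts k l]) ∧
    (∀ S ∈ F₀, ¬ LinearIndependent k (fun i : {x : Fin 8 // x ∈ S} => stdPts k i.1)) := by
  have h_cast (i : Fin 8) (a : Fin 4) := stdPts_map (ZMod.castHom (dvd_refl 2) k) i a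
  refine ⟨fun i j l hij hil hjl => ?_, fun S hS => ?_⟩
  · obtain ⟨c, hc⟩ := exists_minor_stdPts_ne_zero i j l hij hil hjl
    refine LinearIndependent.of_comp (LinearMap.funLeft k k c.succAbove) ?_
    refine Matrix.linearIndependent_rows_of_det_ne_zero (A := Matrix.of fun r s =>
      ![stdPts k i, stdPts k j, stdPts k l] r (c.succAbove s)) ?_
    rw [← map_ne_zero (ZMod.castHom (dvd_refl 2) k), RingHom.map_det] at hc
    convert hc using 2
    ext r s
    fin_cases r <;> exact h_cast _ _
  · rw [Fintype.not_linearIndependent_iff]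
    obtain ⟨x, hx⟩ : S.Nonempty := by
      revert S
      decide +kernel
    refine ⟨1, ?_, ⟨x, hx⟩, one_ne_zero⟩
    ext a
    simp only [Pi.one_apply, one_smul, Finset.sum_apply, Pi.zero_apply]
    rw [Finset.sum_coe_sort S fun i => stdPts k i a]
    simp only [h_cast]
    rw [← map_sum, sum_stdPts_eq_zero S hS a, map_zero]
end

section
/- Let k be a field of characteristic 2 and let v₁,…,v₈ ∈ k⁴ be nonzero vectors such that any three of them are linearly independent, the four vectors v₁, v₂, v₃, v₅ are linearly independent, and for every set S in the family F₀ the four vectors {vᵢ : i ∈ S} are linearly dependent. Then there exist an invertible linear map g ∈ GL(4,k) and nonzero scalars c₁,…,c₈ ∈ k such that g(vᵢ) = cᵢ·pᵢ for all i, where p₁=(1,0,0,0), p₂=(0,1,0,0), p₃=(0,0,1,0), p₄=(1,1,1,0), p₅=(0,0,0,1), p₆=(1,1,0,1), p₇=(1,0,1,1), p₈=(0,1,1,1). -/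
/-- A vector linearly independent from two distinct coordinate vectors of `k⁴` and vanishing at
one of the two remaining coordinates is nonzero at the other one. -/
theorem apply_ne_zero_of_linearIndependent_single {k : Type*} [Field k] {x : Fin 4 → k}
    (i j l m : Fin 4) (hx : LinearIndependent k ![Pi.single i 1, Pi.single j 1, x]) (hm : x m = 0)
    (hd : [i, j, l, m].Nodup := by decide) : x l ≠ 0 := by
  intro hl
  have h := Fintype.linearIndependent_iff.1 hx ![x i, x j, -1] ?_ 2
  · simp at h
  · ext n
    simp only [Fin.sum_univ_three, Pi.add_apply, Pi.smul_apply, smul_eq_mul, Pi.zero_apply,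
      Matrix.cons_val, Pi.single_apply]
    have hn : n = i ∨ n = j ∨ n = l ∨ n = m := by clear hx hm hl; revert i j l m n; decide
    have hij : i ≠ j := by rintro rfl; simp at hd
    rcases hn with rfl | rfl | rfl | rfl
    · simp [hij]
    · simp [hij.symm]
    · have : n ≠ i ∧ n ≠ j := by clear hx hm hl; revert i j n m; decide
      simp [this, hl]
    · have : n ≠ i ∧ n ≠ j := by clear hx hm hl; revert i j n l; decide
      simp [this, hm]

/-- If the vectors of `v` indexed by the image of `f` are dependent, so is the family `v ∘ f`. -/
theorem not_linearIndependent_comp_of_image {k ι κ V : Type*} [Field k] [AddCommGroup V]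
    [Module k V] [Fintype κ] [DecidableEq ι] (v : ι → V) (f : κ → ι)
    (h : ¬ LinearIndependent k (fun i : {x : ι // x ∈ Finset.univ.image f} => v i.1)) :
    ¬ LinearIndependent k (v ∘ f) := by
  intro hf
  have hs (i : {x : ι // x ∈ Finset.univ.image f}) : ∃ j, f j = i.1 := by
    simpa only [Finset.mem_image, Finset.mem_univ, true_and] using i.2
  choose g hg using hs
  have hinj : Function.Injective g := fun a b hab => Subtype.ext (by rw [← hg a, ← hg b, hab])
  apply h
  convert hf.comp g hinj using 1
  ext i
  simp [hg]

/-- Over a field of characteristic 2, if `v₁,…,v₈ ∈ k⁴` are nonzero vectors with any three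
linearly independent, `v₁, v₂, v₃, v₅` linearly independent, and `{vᵢ : i ∈ S}` linearly
dependent for every `S ∈ F₀`, then some invertible linear map of `k⁴` carries each `vᵢ`
to a nonzero scalar multiple of the standard point `pᵢ`. -/
theorem coplanarity_pattern_unique_up_to_projectivity {k : Type*} [Field k] [CharP k 2]
    (v : Fin 8 → Fin 4 → k) (hne : ∀ i, v i ≠ 0)
    (h3 : ∀ i j l : Fin 8, i ≠ j → i ≠ l → j ≠ l → LinearIndependent k ![v i, v j, v l])
    (h4 : LinearIndependent k ![v 0, v 1, v 2, v 4])
    (hdep : ∀ S ∈ F₀, ¬ LinearIndependent k (fun i : {x : Fin 8 // x ∈ S} => v i.1)) :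
    ∃ (g : (Fin 4 → k) ≃ₗ[k] (Fin 4 → k)) (c : Fin 8 → k),
      (∀ i, c i ≠ 0) ∧ ∀ i, g (v i) = c i • stdPts k i := by
  let b := basisOfLinearIndependentOfCardEqFinrank h4 (by simp)
  let φ := b.equivFun
  have hb (i : Fin 4) : φ (![v 0, v 1, v 2, v 4] i) = Pi.single i 1 := by
    have hbi : b i = ![v 0, v 1, v 2, v 4] i := by simp [b]
    ext j
    rw [← hbi, b.equivFun_self, Pi.single_apply]
    simp only [eq_comm]
  have e0 : φ (v 0) = Pi.single 0 1 := hb 0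
  have e1 : φ (v 1) = Pi.single 1 1 := hb 1
  have e2 : φ (v 2) = Pi.single 2 1 := hb 2
  have e4 : φ (v 4) = Pi.single 3 1 := hb 3
  have hdet (f : Fin 4 → Fin 8) (hf : Finset.univ.image f ∈ F₀) :
      (Matrix.of (φ ∘ v ∘ f)).det = 0 := by
    by_contra h
    refine not_linearIndependent_comp_of_image v f (hdep _ hf) ?_
    refine LinearIndependent.of_comp φ.toLinearMap ?_
    exact Matrix.linearIndependent_rows_of_det_ne_zero h
  have hli (i j l : Fin 8) (hd : i ≠ j ∧ i ≠ l ∧ j ≠ l) :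
      LinearIndependent k ![φ (v i), φ (v j), φ (v l)] := by
    have h := (h3 i j l hd.1 hd.2.1 hd.2.2).map' φ.toLinearMap φ.ker
    rwa [show φ.toLinearMap ∘ ![v i, v j, v l] = ![φ (v i), φ (v j), φ (v l)] by
      ext1 n; fin_cases n <;> rfl] at h
  generalize hw : (fun i => φ (v i)) = w
  have hwi (i : Fin 8) : φ (v i) = w i := congrFun hw i
  have hcomp : φ ∘ v = w := hw
  simp only [← Function.comp_assoc, hcomp] at hdet
  simp only [hwi] at hli e0 e1 e2 e4
  have z3 : w 3 3 = 0 := by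
    simpa [Matrix.det_succ_row_zero, Fin.sum_univ_succ, e0, e1, e2, Fin.succAbove,
      Pi.single_apply] using hdet ![0, 1, 2, 3] (by decide)
  have z5 : w 5 2 = 0 := by
    simpa [Matrix.det_succ_row_zero, Fin.sum_univ_succ, e0, e1, e4, Fin.succAbove,
      Pi.single_apply] using hdet ![0, 1, 4, 5] (by decide)
  have z6 : w 6 1 = 0 := by
    simpa [Matrix.det_succ_row_zero, Fin.sum_univ_succ, e0, e2, e4, Fin.succAbove,
      Pi.single_apply] using hdet ![0, 2, 4, 6] (by decide)
  have z7 : w 7 0 = 0 := by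
    simpa [Matrix.det_succ_row_zero, Fin.sum_univ_succ, e1, e2, e4, Fin.succAbove,
      Pi.single_apply] using hdet ![1, 2, 4, 7] (by decide)
  have n30 : w 3 0 ≠ 0 :=
    apply_ne_zero_of_linearIndependent_single 1 2 0 3
      (by simpa only [e1, e2] using hli 1 2 3 (by decide)) z3
  have n31 : w 3 1 ≠ 0 :=
    apply_ne_zero_of_linearIndependent_single 0 2 1 3
      (by simpa only [e0, e2] using hli 0 2 3 (by decide)) z3
  have n32 : w 3 2 ≠ 0 :=
    apply_ne_zero_of_linearIndependent_single 0 1 2 3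
      (by simpa only [e0, e1] using hli 0 1 3 (by decide)) z3
  have n50 : w 5 0 ≠ 0 :=
    apply_ne_zero_of_linearIndependent_single 1 3 0 2
      (by simpa only [e1, e4] using hli 1 4 5 (by decide)) z5
  have n53 : w 5 3 ≠ 0 :=
    apply_ne_zero_of_linearIndependent_single 0 1 3 2
      (by simpa only [e0, e1] using hli 0 1 5 (by decide)) z5
  have n60 : w 6 0 ≠ 0 :=
    apply_ne_zero_of_linearIndependent_single 2 3 0 1
      (by simpa only [e2, e4] using hli 2 4 6 (by decide)) z6
  have n71 : w 7 1 ≠ 0 :=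
    apply_ne_zero_of_linearIndependent_single 2 3 1 0
      (by simpa only [e2, e4] using hli 2 4 7 (by decide)) z7
  have r56 : w 5 0 * w 6 3 = w 5 3 * w 6 0 := by
    have h := hdet ![1, 2, 5, 6] (by decide)
    simp [Matrix.det_succ_row_zero, Fin.sum_univ_succ, e1, e2, Fin.succAbove,
      Pi.single_apply] at h
    grind
  have r57 : w 5 1 * w 7 3 = w 5 3 * w 7 1 := by
    have h := hdet ![0, 2, 5, 7] (by decide)
    simp [Matrix.det_succ_row_zero, Fin.sum_univ_succ, e0, e2, Fin.succAbove,
      Pi.single_apply] at h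
    grind
  have r37 : w 3 1 * w 7 2 = w 3 2 * w 7 1 := by
    have h := hdet ![0, 3, 4, 7] (by decide)
    simp [Matrix.det_succ_row_zero, Fin.sum_univ_succ, e0, e4, Fin.succAbove,
      Pi.single_apply] at h
    grind
  have r36 : w 3 0 * w 6 2 = w 3 2 * w 6 0 := by
    have h := hdet ![1, 3, 4, 6] (by decide)
    simp [Matrix.det_succ_row_zero, Fin.sum_univ_succ, e1, e4, Fin.succAbove,
      Pi.single_apply] at h
    grind
  have r35 : w 3 0 * w 5 1 = w 3 1 * w 5 0 := by
    have h := hdet ![2, 3, 4, 5] (by decide)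
    simp [Matrix.det_succ_row_zero, Fin.sum_univ_succ, e2, e4, Fin.succAbove,
      Pi.single_apply] at h
    grind
  let s : Fin 4 → k := ![(w 3 0)⁻¹, (w 3 1)⁻¹, (w 3 2)⁻¹, w 5 0 / (w 3 0 * w 5 3)]
  have hs (i : Fin 4) : s i ≠ 0 := by fin_cases i <;> simp [s, *]
  refine ⟨φ.trans (LinearEquiv.piCongrRight fun i => LinearEquiv.smulOfNeZero k k (s i) (hs i)),
    ![(w 3 0)⁻¹, (w 3 1)⁻¹, (w 3 2)⁻¹, 1, w 5 0 / (w 3 0 * w 5 3), w 5 0 / w 3 0,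
      w 6 0 / w 3 0, w 7 1 / w 3 1], ?_, ?_⟩
  · intro i
    fin_cases i <;> simp [*]
  · intro i
    ext j
    simp only [LinearEquiv.trans_apply, LinearEquiv.piCongrRight_apply, hwi,
      LinearEquiv.smulOfNeZero_apply, Pi.smul_apply, smul_eq_mul]
    fin_cases i <;> fin_cases j <;>
      simp [s, stdPts, e0, e1, e2, e4, z3, z5, z6, z7, n30, n31, n32] <;> field_simp <;> grind
end

section
/- Let k be a field and let (x,y,z,w) ∈ k⁴ be a nonzero vector satisfying yz + w² = 0, xz + yw = 0 and xw − y² + z² = 0. Then y = z = w = 0; that is, the only common projective zero of the net ⟨YZ+W², XZ+YW, XW−Y²+Z²⟩ is the point [1:0:0:0]. -/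
/-- The only common projective zero of the net `⟨YZ+W², XZ+YW, XW−Y²+Z²⟩` (the standard
form of the extremal net of type {8}₂) is the point `[1:0:0:0]`: any nonzero solution
`(x,y,z,w)` has `y = z = w = 0`. -/
theorem base_locus_of_type_eight_two {k : Type*} [Field k] (x y z w : k)
    (hne : ¬ (x = 0 ∧ y = 0 ∧ z = 0 ∧ w = 0))
    (h1 : y * z + w ^ 2 = 0) (h2 : x * z + y * w = 0) (h3 : x * w - y ^ 2 + z ^ 2 = 0) :
    y = 0 ∧ z = 0 ∧ w = 0 := by
  have hz : z = 0 := by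
    have : z ^ 4 = 0 := by
      linear_combination z ^ 2 * h3 - z * w * h2 + y * z * h1
    exact pow_eq_zero_iff four_ne_zero |>.mp this
  subst hz
  have hw : w = 0 := by simpa using h1
  subst hw
  have hy : y = 0 := by simpa using h3
  exact ⟨hy, rfl, rfl⟩
end

section
/- Let k be a field and let (x,y,z,w) ∈ k⁴ be a nonzero vector satisfying z² = 0, x(y+w) + yw = 0 and xz + (y+w)² = 0. Then y = z = w = 0; that is, the only common projective zero of the net ⟨Z², X(Y+W)+YW, XZ+(Y+W)²⟩ is the point [1:0:0:0]. -/
/-- The only common projective zero of the net `⟨Z², X(Y+W)+YW, XZ+(Y+W)²⟩` (the standard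
form of the extremal net of type {8}₁) is the point `[1:0:0:0]`: any nonzero solution
`(x,y,z,w)` has `y = z = w = 0`. -/
theorem base_locus_of_type_eight_one {k : Type*} [Field k] (x y z w : k)
    (hne : ¬ (x = 0 ∧ y = 0 ∧ z = 0 ∧ w = 0))
    (h1 : z ^ 2 = 0) (h2 : x * (y + w) + y * w = 0) (h3 : x * z + (y + w) ^ 2 = 0) :
    y = 0 ∧ z = 0 ∧ w = 0 := by
  have hz : z = 0 := pow_eq_zero_iff two_ne_zero |>.mp h1
  have hyw : y + w = 0 := by
    rw [hz, mul_zero, zero_add] at h3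
    exact pow_eq_zero_iff two_ne_zero |>.mp h3
  have hy : y = 0 := by
    have hy2 : y ^ 2 = 0 := by linear_combination (x + y) * hyw - h2
    exact pow_eq_zero_iff two_ne_zero |>.mp hy2
  exact ⟨hy, hz, by rwa [hy, zero_add] at hyw⟩
end

section
/- Let k be a field and let (x,y,z,w) ∈ k⁴ be a nonzero vector satisfying yz = 0, xz + w² = 0 and xy + z² = 0. Then (x,y,z,w) is a nonzero scalar multiple of (1,0,0,0) or of (0,1,0,0); that is, the common projective zeros of the net ⟨YZ, XZ+W², XY+Z²⟩ are exactly the two points [1:0:0:0] and [0:1:0:0]. -/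
/-- The common projective zeros of the net `⟨YZ, XZ+W², XY+Z²⟩` (the standard form of the
extremal net of type {6,2}) are exactly the two points `[1:0:0:0]` and `[0:1:0:0]`: any
nonzero solution `(x,y,z,w)` is a nonzero scalar multiple of `(1,0,0,0)` or `(0,1,0,0)`. -/
theorem base_locus_of_type_62 {k : Type*} [Field k] (x y z w : k)
    (hne : ¬ (x = 0 ∧ y = 0 ∧ z = 0 ∧ w = 0))
    (h1 : y * z = 0) (h2 : x * z + w ^ 2 = 0) (h3 : x * y + z ^ 2 = 0) :
    ∃ c : k, c ≠ 0 ∧ ((x, y, z, w) = (c, 0, 0, 0) ∨ (x, y, z, w) = (0, c, 0, 0)) := by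
  have hz : z = 0 := pow_eq_zero_iff three_ne_zero |>.mp <| by
    linear_combination z * h3 - x * h1
  subst hz
  have hw : w = 0 := by simpa using h2
  subst hw
  have hxy : x = 0 ∨ y = 0 := by simpa using h3
  rcases hxy with rfl | rfl
  · exact ⟨y, by simpa using hne, Or.inr rfl⟩
  · exact ⟨x, by simpa using hne, Or.inl rfl⟩
end

section
/- Let k be a field and let (x,y,z,w) ∈ k⁴ be a nonzero vector satisfying yz = 0, xw + z² = 0 and xy + w² = 0. Then (x,y,z,w) is a nonzero scalar multiple of (1,0,0,0) or of (0,1,0,0); that is, the common projective zeros of the net ⟨YZ, XW+Z², XY+W²⟩ are exactly the two points [1:0:0:0] and [0:1:0:0]. -/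
/-- The common projective zeros of the net `⟨YZ, XW+Z², XY+W²⟩` (the standard form of the
extremal net of type {5,3}) are exactly the two points `[1:0:0:0]` and `[0:1:0:0]`: any
nonzero solution `(x,y,z,w)` is a nonzero scalar multiple of `(1,0,0,0)` or `(0,1,0,0)`. -/
theorem base_locus_of_type_53 {k : Type*} [Field k] (x y z w : k)
    (hne : ¬ (x = 0 ∧ y = 0 ∧ z = 0 ∧ w = 0))
    (h1 : y * z = 0) (h2 : x * w + z ^ 2 = 0) (h3 : x * y + w ^ 2 = 0) :
    ∃ c : k, c ≠ 0 ∧ ((x, y, z, w) = (c, 0, 0, 0) ∨ (x, y, z, w) = (0, c, 0, 0)) := by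
  have hw : w = 0 := by
    rcases mul_eq_zero.mp h1 with rfl | rfl
    · simpa using h3
    · rcases mul_eq_zero.mp (show x * w = 0 by simpa using h2) with rfl | hw
      · simpa using h3
      · exact hw
  subst hw
  have hz : z = 0 := by simpa using h2
  subst hz
  rcases mul_eq_zero.mp (show x * y = 0 by simpa using h3) with rfl | rfl
  · exact ⟨y, fun hy => hne ⟨rfl, hy, rfl, rfl⟩, Or.inr rfl⟩
  · exact ⟨x, fun hx => hne ⟨hx, rfl, rfl, rfl⟩, Or.inl rfl⟩
end

section
/- Let k be a field of characteristic 2 and let (x,y,z,w) ∈ k⁴ be a nonzero vector satisfying (x+y+z)w = 0, (x+y+w)z = 0 and (x+z+w)y = 0. Then (x,y,z,w) is a nonzero scalar multiple of one of the eight vectors (1,0,0,0), (0,1,0,0), (0,0,1,0), (1,1,1,0), (0,0,0,1), (1,1,0,1), (1,0,1,1), (0,1,1,1); that is, the common projective zeros of the net ⟨(X+Y+Z)W, (X+Y+W)Z, (X+Z+W)Y⟩ are exactly these eight points of ℙ³. -/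
/-- Over a field of characteristic 2, the common projective zeros of the net
`⟨(X+Y+Z)W, (X+Y+W)Z, (X+Z+W)Y⟩` (the standard form of the extremal net of type
{1,1,1,1,1,1,1,1}) are exactly the eight points `[1:0:0:0]`, `[0:1:0:0]`, `[0:0:1:0]`,
`[1:1:1:0]`, `[0:0:0:1]`, `[1:1:0:1]`, `[1:0:1:1]`, `[0:1:1:1]` of ℙ³. -/
theorem base_locus_of_type_eight_ones {k : Type*} [Field k] [CharP k 2] (x y z w : k)
    (hne : ¬ (x = 0 ∧ y = 0 ∧ z = 0 ∧ w = 0))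
    (h1 : (x + y + z) * w = 0) (h2 : (x + y + w) * z = 0) (h3 : (x + z + w) * y = 0) :
    ∃ c : k, c ≠ 0 ∧
      ((x, y, z, w) = (c, 0, 0, 0) ∨ (x, y, z, w) = (0, c, 0, 0) ∨
        (x, y, z, w) = (0, 0, c, 0) ∨ (x, y, z, w) = (c, c, c, 0) ∨
        (x, y, z, w) = (0, 0, 0, c) ∨ (x, y, z, w) = (c, c, 0, c) ∨
        (x, y, z, w) = (c, 0, c, c) ∨ (x, y, z, w) = (0, c, c, c)) := by
  have eq_of_add {a b : k} (h : a + b = 0) : a = b := CharTwo.add_eq_zero.mp h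
  simp only [Prod.mk.injEq]
  by_cases hw : w = 0 <;> by_cases hz : z = 0 <;> by_cases hy : y = 0 <;>
    simp only [hw, hz, hy, mul_zero, mul_eq_zero, or_false, add_zero] at h1 h2 h3
  · exact ⟨x, fun hx => hne ⟨hx, hy, hz, hw⟩, by simp [hw, hz, hy]⟩
  · exact ⟨y, hy, by simp [hw, hz, h3]⟩
  · exact ⟨z, hz, by simp [hw, hy, h2]⟩
  · exact ⟨y, hy, by simp [hw, eq_of_add h2, ← eq_of_add h3]⟩
  · exact ⟨w, hw, by simp [hz, hy, h1]⟩
  · exact ⟨y, hy, by simp [hz, eq_of_add h1, ← eq_of_add h3]⟩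
  · exact ⟨z, hz, by simp [hy, eq_of_add h1, ← eq_of_add h2]⟩
  · have hzx : x + y = z := eq_of_add h1
    have hwx : x + y = w := eq_of_add h2
    have hzw : z = w := hzx.symm.trans hwx
    have hx : x = 0 := by
      rw [add_assoc, hzw, CharTwo.add_self_eq_zero, add_zero] at h3
      exact h3
    rw [hx, zero_add] at hzx hwx
    exact ⟨y, hy, by simp [hx, ← hzx, ← hwx]⟩
end
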